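/- arXiv:1810.01602 — 4 statements merged into one kernel-verified Lean document; each statement's English description precedes it below -/
import Mathlib

section
/- Let d ≥ 1 and p ≥ 2 be integers, α > d and C > 0 real numbers, and define f(ρ) = C/(1 + ρ^α) for ρ > 0. Let (R_n) be a sequence of positive reals such that n^p · R_n^d · (f(R_n))^p → 0 and n^{p−1} · R_n^d · (f(R_n))^{p−1} → ∞ as n → ∞. Then R_n^{−1} · (Cn)^{p/(αp−d)} → 0 as n → ∞. -/
open Filter Topology

/-- Under condition (3.6) with `M ≡ 1`, for the Pareto-type density any admissible `R n`
grows faster than `(C n)^{p/(αp-d)}` from Example 3.4. -/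
theorem stmt_5 (d p : ℕ) (hd : 1 ≤ d) (hp : 2 ≤ p) (α C : ℝ) (hα : (d : ℝ) < α) (hC : 0 < C)
    (f : ℝ → ℝ) (hf : ∀ ρ : ℝ, 0 < ρ → f ρ = C / (1 + ρ ^ α))
    (R : ℕ → ℝ) (hRpos : ∀ n, 0 < R n)
    (h1 : Tendsto (fun n : ℕ => (n : ℝ) ^ p * (R n) ^ d * (f (R n)) ^ p) atTop (𝓝 0))
    (h2 : Tendsto (fun n : ℕ => (n : ℝ) ^ (p - 1) * (R n) ^ d * (f (R n)) ^ (p - 1))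
      atTop atTop) :
    Tendsto (fun n : ℕ => (R n)⁻¹ * (C * n) ^ ((p : ℝ) / (α * p - d))) atTop (𝓝 0) := by
  have hdR : (1:ℝ) ≤ d := by exact_mod_cast hd
  have hpR : (2:ℝ) ≤ p := by exact_mod_cast hp
  have hα0 : 0 < α := by linarith
  have hk : 0 < α * p - d := by nlinarith
  have hfpos : ∀ n, 0 < f (R n) := by
    intro n
    rw [hf _ (hRpos n)]
    have := Real.rpow_pos_of_pos (hRpos n) α
    positivity
  have ha : Tendsto (fun n : ℕ => (n : ℝ) * f (R n)) atTop (𝓝 0) := by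
    have h3 := h1.mul h2.inv_tendsto_atTop
    rw [zero_mul] at h3
    refine h3.congr' ?_
    filter_upwards [eventually_ge_atTop 1] with n hn
    have hn' : (0:ℝ) < n := by exact_mod_cast hn
    have h4 := hfpos n
    have h5 := hRpos n
    obtain ⟨q, rfl⟩ : ∃ q, p = q + 1 := ⟨p - 1, by omega⟩
    simp only [Pi.inv_apply, Nat.add_sub_cancel]
    field_simp
    ring
  have hR1 : ∀ᶠ n : ℕ in atTop, 1 ≤ R n := by
    filter_upwards [eventually_ge_atTop 1, ha.eventually_lt_const (show (0:ℝ) < C / 2 by positivity)] with n hn hlt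
    have hn' : (1:ℝ) ≤ n := by exact_mod_cast hn
    by_contra hcon
    push Not at hcon
    have h6 : (R n) ^ α ≤ 1 := Real.rpow_le_one (hRpos n).le hcon.le hα0.le
    have h7 := Real.rpow_pos_of_pos (hRpos n) α
    have h8 : C / 2 ≤ f (R n) := by
      rw [hf _ (hRpos n)]
      exact div_le_div_of_nonneg_left hC.le (by linarith) (by linarith)
    nlinarith [hfpos n]
  have hg : Tendsto (fun n : ℕ => (C * n) ^ p * (R n) ^ d / ((R n) ^ α) ^ p) atTop (𝓝 0) := by
    have h3 := h1.const_mul ((2:ℝ) ^ p)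
    rw [mul_zero] at h3
    refine squeeze_zero' ?_ ?_ h3
    · refine Eventually.of_forall fun n => ?_
      have h7 := Real.rpow_pos_of_pos (hRpos n) α
      have h5 := hRpos n
      positivity
    · filter_upwards [hR1] with n hn
      have h5 := hRpos n
      have h7 := Real.rpow_pos_of_pos (hRpos n) α
      have h8 : 1 ≤ (R n) ^ α := Real.one_le_rpow hn hα0.le
      have h9 : C / (R n) ^ α ≤ 2 * f (R n) := by
        rw [hf _ h5, ← mul_div_assoc, div_le_div_iff₀ h7 (by linarith)]
        nlinarith
      have h10 : (C / (R n) ^ α) ^ p ≤ (2 * f (R n)) ^ p :=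
        pow_le_pow_left₀ (by positivity) h9 p
      calc (C * n) ^ p * (R n) ^ d / ((R n) ^ α) ^ p
          = ((n:ℝ) ^ p * (R n) ^ d) * (C / (R n) ^ α) ^ p := by
            rw [mul_pow, div_pow]; ring
        _ ≤ ((n:ℝ) ^ p * (R n) ^ d) * (2 * f (R n)) ^ p :=
            mul_le_mul_of_nonneg_left h10 (by positivity)
        _ = _ := by rw [mul_pow]; ring
  have hfin := hg.rpow_const (p := 1 / (α * p - d)) (Or.inr (by positivity))
  rw [Real.zero_rpow (by positivity)] at hfin
  refine hfin.congr fun n => ?_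
  have h5 := hRpos n
  have hCn : 0 ≤ C * (n:ℝ) := by positivity
  have e1 : (C * (n:ℝ)) ^ p * (R n) ^ d / ((R n) ^ α) ^ p
      = (C * (n:ℝ)) ^ (p:ℝ) * (R n) ^ (-(α * p - d)) := by
    rw [neg_sub, Real.rpow_sub h5, Real.rpow_mul h5.le, Real.rpow_natCast, Real.rpow_natCast,
      Real.rpow_natCast, mul_div_assoc]
  rw [e1, Real.mul_rpow (by positivity) (by positivity), ← Real.rpow_mul hCn,
    ← Real.rpow_mul h5.le, mul_one_div, neg_mul, mul_one_div_cancel hk.ne', Real.rpow_neg_one,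
    mul_comm]
end

section
/- Let τ ∈ (0,1], C > 0, and integers d ≥ 1, p ≥ 1. For all sufficiently large natural numbers n define R_n = (τ · log n + p^{−1}(d−τ) · log(τ · log n) + τ · log C)^{1/τ}. Then n^p · R_n^{d−τ} · C^p · exp(−p · R_n^τ / τ) → 1 as n → ∞. -/
open Filter Topology Real

/-- For the density `f(x) = C exp(-‖x‖^τ/τ)` the explicit logarithmic sequence
`R n = (τ log n + p⁻¹(d-τ) log(τ log n) + τ log C)^{1/τ}` solves the asymptotic
equation `n^p R_n^{d-τ} C^p exp(-p R_n^τ/τ) → 1`. -/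
theorem stmt_7 (τ C : ℝ) (hτ0 : 0 < τ) (hτ1 : τ ≤ 1) (hC : 0 < C)
    (d p : ℕ) (hd : 1 ≤ d) (hp : 1 ≤ p)
    (R : ℕ → ℝ)
    (hR : ∀ᶠ n : ℕ in atTop,
      R n = (τ * Real.log n + (p : ℝ)⁻¹ * ((d : ℝ) - τ) * Real.log (τ * Real.log n)
        + τ * Real.log C) ^ (1 / τ)) :
    Tendsto (fun n : ℕ =>
      (n : ℝ) ^ p * (R n) ^ ((d : ℝ) - τ) * C ^ p * Real.exp (-(p : ℝ) * (R n) ^ τ / τ))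
      atTop (𝓝 1) := by
  have hpp : (0:ℝ) < p := by exact_mod_cast hp
  have hL : Tendsto (fun n : ℕ => τ * Real.log n) atTop atTop :=
    (Real.tendsto_log_atTop.comp tendsto_natCast_atTop_atTop).const_mul_atTop hτ0
  have hq : Tendsto (fun x : ℝ => (x + (p : ℝ)⁻¹ * ((d : ℝ) - τ) * Real.log x
      + τ * Real.log C) / x) atTop (𝓝 1) := by
    have h1 : Tendsto (fun x : ℝ => Real.log x / x) atTop (𝓝 0) :=
      Real.isLittleO_log_id_atTop.tendsto_div_nhds_zero
    have h2 := ((h1.const_mul ((p : ℝ)⁻¹ * ((d : ℝ) - τ))).const_add 1).add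
      (tendsto_inv_atTop_zero.const_mul (τ * Real.log C))
    simp only [mul_zero, add_zero] at h2
    refine h2.congr' ?_
    filter_upwards [eventually_gt_atTop 0] with x hx
    field_simp
  have hA := hq.comp hL
  have hlim : Tendsto (fun n : ℕ => ((τ * Real.log n + (p : ℝ)⁻¹ * ((d : ℝ) - τ) *
      Real.log (τ * Real.log n) + τ * Real.log C) / (τ * Real.log n)) ^ (((d : ℝ) - τ) / τ))
      atTop (𝓝 1) := by
    have h := hA.rpow_const (p := ((d : ℝ) - τ) / τ) (Or.inl one_ne_zero)
    rw [Real.one_rpow] at h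
    exact h
  refine hlim.congr' ?_
  filter_upwards [hR, hL.eventually_gt_atTop 0, hA.eventually_const_lt zero_lt_one,
    eventually_gt_atTop 0] with n hRn hLn hAn hn
  have hn' : (0:ℝ) < n := by exact_mod_cast hn
  simp only [Function.comp] at hAn
  rw [hRn]
  set L := τ * Real.log n with hLdef
  set A := L + (p : ℝ)⁻¹ * ((d : ℝ) - τ) * Real.log L + τ * Real.log C with hAdef
  have hApos : 0 < A := by
    have := mul_pos hAn hLn
    rwa [div_mul_cancel₀ _ hLn.ne'] at this
  have e1 : (A ^ (1 / τ)) ^ τ = A := by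
    rw [← Real.rpow_mul hApos.le, one_div_mul_cancel hτ0.ne', Real.rpow_one]
  have e2 : (A ^ (1 / τ)) ^ ((d : ℝ) - τ) = Real.exp (Real.log A * (((d : ℝ) - τ) / τ)) := by
    rw [← Real.rpow_mul hApos.le, Real.rpow_def_of_pos hApos]
    congr 1; ring
  have e3 : (n : ℝ) ^ p = Real.exp (p * Real.log n) := by
    rw [Real.exp_nat_mul, Real.exp_log hn']
  have e4 : C ^ p = Real.exp (p * Real.log C) := by
    rw [Real.exp_nat_mul, Real.exp_log hC]
  rw [e1, e2, e3, e4, ← Real.exp_add, ← Real.exp_add, ← Real.exp_add,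
    Real.rpow_def_of_pos (div_pos hApos hLn), Real.log_div hApos.ne' hLn.ne']
  congr 1
  have e5 : -(p : ℝ) * A / τ = -(p * Real.log n) - ((d : ℝ) - τ) / τ * Real.log L
      - p * Real.log C := by
    rw [hAdef]
    generalize Real.log L = l
    rw [hLdef]
    field_simp
    ring
  rw [e5]
  ring
end

section
/- Let d ≥ 1 and m ≥ 2 be integers. Let A ⊂ (ℝ^d)^{m−1} be the set of all (y₁, …, y_{m−1}) such that the graph on the m labeled vertices p₀ = 0, p₁ = y₁, …, p_{m−1} = y_{m−1}, with an edge between indices i ≠ j if and only if ‖p_i − p_j‖ < 2, is connected. Then the Lebesgue measure of A in ℝ^{d(m−1)} is at most m^{m−2} · V_d^{m−1}, where V_d is the Lebesgue measure of a Euclidean ball of radius 2 in ℝ^d. -/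
open MeasureTheory

namespace CayleyVol

/-- Cut formulation: every point `y s` is joined to some root `p i`. -/
def Conn {d : ℕ} {ρ σ : Type} (p : ρ → EuclideanSpace ℝ (Fin d))
    (y : σ → EuclideanSpace ℝ (Fin d)) : Prop :=
  ∀ W : Finset σ, W.Nonempty →
    ∃ w ∈ W, (∃ i, dist (y w) (p i) < 2) ∨ ∃ v, v ∉ W ∧ dist (y w) (y v) < 2

/-- Number of forests on `r` roots and `s` further vertices. -/
def cc (r s : ℕ) : ℕ := if s = 0 then 1 else r * (r + s) ^ (s - 1)

lemma cc_sum (r n : ℕ) :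
    ∑ k ∈ Finset.range (n + 2), (n + 1).choose k * (r ^ k * cc k (n + 1 - k))
      = r * (r + (n + 1)) ^ n := by
  rw [Finset.sum_range_succ', add_pow, Finset.mul_sum]
  have h0 : (n + 1).choose 0 * (r ^ 0 * cc 0 (n + 1 - 0)) = 0 := by simp [cc]
  rw [h0, add_zero]
  refine Finset.sum_congr rfl fun j hj => ?_
  have hj' : j ≤ n := by simpa [Nat.lt_succ_iff] using hj
  have key : (n + 1).choose (j + 1) * cc (j + 1) (n + 1 - (j + 1))
      = n.choose j * (n + 1) ^ (n - j) := by
    rcases hj'.eq_or_lt with h | h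
    · subst h; simp [cc]
    · obtain ⟨q, rfl⟩ : ∃ q, n = j + q + 1 := ⟨n - j - 1, by omega⟩
      have e1 : j + q + 1 + 1 - (j + 1) = q + 1 := by omega
      have e2 : j + q + 1 - j = q + 1 := by omega
      have := Nat.add_one_mul_choose_eq (j + q + 1) j
      rw [e1, e2]
      simp only [cc, Nat.succ_ne_zero, if_false, Nat.add_sub_cancel]
      have e3 : j + 1 + (q + 1) = j + q + 1 + 1 := by omega
      rw [e3, ← mul_assoc, ← this, pow_succ]
      ring
  calc _ = r ^ (j + 1) * ((n + 1).choose (j + 1) * cc (j + 1) (n + 1 - (j + 1))) := by ring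
    _ = _ := by rw [key, pow_succ]; simp only [Nat.cast_id]; ring

lemma isOpen_conn {d : ℕ} {ρ σ X : Type} [Fintype ρ] [Fintype σ] [TopologicalSpace X]
    (p : X → ρ → EuclideanSpace ℝ (Fin d)) (y : X → σ → EuclideanSpace ℝ (Fin d))
    (hp : Continuous p) (hy : Continuous y) :
    IsOpen {x | Conn (p x) (y x)} := by
  have : {x | Conn (p x) (y x)} = ⋂ W : Finset σ, ⋂ _ : W.Nonempty, ⋃ w ∈ W,
      ((⋃ i, {x | dist (y x w) (p x i) < 2}) ∪
        ⋃ v, ⋃ _ : v ∉ W, {x | dist (y x w) (y x v) < 2}) := by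
    ext x; simp [Conn]
  rw [this]
  refine isOpen_iInter_of_finite fun W => isOpen_iInter_of_finite fun _ =>
    isOpen_biUnion fun w _ => IsOpen.union (isOpen_iUnion fun i => ?_)
      (isOpen_iUnion fun v => isOpen_iUnion fun _ => ?_)
  · exact isOpen_lt (by fun_prop) continuous_const
  · exact isOpen_lt (by fun_prop) continuous_const

lemma main_bound (d : ℕ) : ∀ (s : ℕ) (σ ρ : Type) [Fintype σ] [Fintype ρ]
    (p : ρ → EuclideanSpace ℝ (Fin d)), Fintype.card σ = s →
    volume {y : σ → EuclideanSpace ℝ (Fin d) | Conn p y} ≤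
      (cc (Fintype.card ρ) s : ENNReal) *
        (volume (Metric.ball (0 : EuclideanSpace ℝ (Fin d)) 2)) ^ s := by
  classical
  intro s
  induction s using Nat.strong_induction_on with
  | _ s ih =>
  intro σ ρ _ _ p hs
  set V := volume (Metric.ball (0 : EuclideanSpace ℝ (Fin d)) 2) with hV
  rcases Nat.eq_zero_or_pos s with h0 | hpos
  · subst h0
    have : IsEmpty σ := Fintype.card_eq_zero_iff.mp hs
    refine (measure_mono (Set.subset_univ _)).trans ?_
    rw [← Set.pi_univ Set.univ, volume_pi_pi]
    simp [cc]
  set U : Set (EuclideanSpace ℝ (Fin d)) := ⋃ i, Metric.ball (p i) 2 with hU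
  have hUo : IsOpen U := isOpen_iUnion fun i => Metric.isOpen_ball
  have hUv : volume U ≤ (Fintype.card ρ : ENNReal) * V := by
    refine (measure_iUnion_le _).trans ?_
    simp [tsum_fintype, Measure.addHaar_ball_center, hV]
  -- the piece attached to `T`
  let B : (T : Finset σ) → Set (({x // x ∈ T} → EuclideanSpace ℝ (Fin d)) ×
      ({x // x ∉ T} → EuclideanSpace ℝ (Fin d))) :=
    fun T => {q | (∀ t, q.1 t ∈ U) ∧ Conn q.1 q.2}
  have hBm : ∀ T, MeasurableSet (B T) := by
    intro T
    refine (IsOpen.inter ?_ (isOpen_conn _ _ continuous_fst continuous_snd)).measurableSet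
    have : {q : ({x // x ∈ T} → EuclideanSpace ℝ (Fin d)) ×
      ({x // x ∉ T} → EuclideanSpace ℝ (Fin d)) | ∀ t, q.1 t ∈ U} =
        ⋂ t, (fun q => q.1 t) ⁻¹' U := by ext; simp
    change IsOpen {q : ({x // x ∈ T} → EuclideanSpace ℝ (Fin d)) ×
      ({x // x ∉ T} → EuclideanSpace ℝ (Fin d)) | ∀ t, q.1 t ∈ U}
    rw [this]
    exact isOpen_iInter_of_finite fun t => hUo.preimage (by fun_prop)
  have hB : ∀ T : Finset σ, volume (B T) ≤
      ((Fintype.card ρ ^ T.card * cc T.card (s - T.card) : ℕ) : ENNReal) * V ^ s := by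
    intro T
    have hTs : T.card ≤ s := hs ▸ Finset.card_le_univ T
    have hcT : Fintype.card {x // x ∈ T} = T.card := Fintype.card_coe T
    have hcT' : Fintype.card {x // x ∉ T} = s - T.card := by
      rw [Fintype.card_subtype_compl, hcT, hs]
    have hfib : ∀ a : {x // x ∈ T} → EuclideanSpace ℝ (Fin d),
        volume (Prod.mk a ⁻¹' B T) ≤ (Set.pi Set.univ fun _ => U).indicator
          (fun _ => (cc T.card (s - T.card) : ENNReal) * V ^ (s - T.card)) a := by
      intro a
      by_cases ha : ∀ t, a t ∈ U
      · rw [Set.indicator_of_mem (by simpa using ha)]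
        have hsub : Prod.mk a ⁻¹' B T ⊆ {b | Conn a b} := fun b hb => hb.2
        refine (measure_mono hsub).trans ?_
        rcases T.eq_empty_or_nonempty with hT | hT
        · -- no roots, at least one vertex: the set is empty
          have hne : Nonempty {x // x ∉ T} := by
            rw [← Fintype.card_pos_iff, hcT', hT]; simpa using hpos
          have : {b : {x // x ∉ T} → EuclideanSpace ℝ (Fin d) | Conn a b} = ∅ := by
            ext b
            simp only [Set.mem_ofPred_eq, Set.mem_empty_iff_false, iff_false]
            intro hb
            obtain ⟨w, _, ⟨i, _⟩ | ⟨v, hv, _⟩⟩ := hb Finset.univ Finset.univ_nonempty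
            · have := i.2; simp [hT] at this
            · exact hv (Finset.mem_univ _)
          rw [this]; simp
        · have := ih (s - T.card) (by have := hT.card_pos; omega) {x // x ∉ T} {x // x ∈ T} a hcT'
          rwa [hcT] at this
      · have : Prod.mk a ⁻¹' B T = ∅ := by
          ext b; simp only [Set.mem_preimage, Set.mem_empty_iff_false, iff_false]
          exact fun hb => ha hb.1
        rw [this]; simp
    have hms : MeasurableSet (Set.pi Set.univ fun _ : {x // x ∈ T} => U) :=
      MeasurableSet.univ_pi fun _ => hUo.measurableSet
    rw [Measure.volume_eq_prod, Measure.prod_apply (hBm T)]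
    refine (lintegral_mono hfib).trans ?_
    rw [lintegral_indicator_const hms, volume_pi_pi, Finset.prod_const, Finset.card_univ, hcT]
    calc _ ≤ (cc T.card (s - T.card) : ENNReal) * V ^ (s - T.card) *
          ((Fintype.card ρ : ENNReal) * V) ^ T.card := by gcongr
      _ = ((Fintype.card ρ ^ T.card * cc T.card (s - T.card) : ℕ) : ENNReal) *
          (V ^ (s - T.card) * V ^ T.card) := by push_cast; rw [mul_pow]; ring
      _ = _ := by rw [← pow_add, Nat.sub_add_cancel hTs]
  have hcover : {y : σ → EuclideanSpace ℝ (Fin d) | Conn p y} ⊆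
      ⋃ T : Finset σ, (MeasurableEquiv.piEquivPiSubtypeProd
        (fun _ : σ => EuclideanSpace ℝ (Fin d)) (fun x => x ∈ T)) ⁻¹' B T := by
    intro y hy
    refine Set.mem_iUnion.mpr ⟨Finset.univ.filter fun t => y t ∈ U, ?_⟩
    refine ⟨fun t => (Finset.mem_filter.mp t.2).2, ?_⟩
    intro W hW
    obtain ⟨w, hw, h⟩ := hy (W.map (Function.Embedding.subtype _)) (hW.map)
    obtain ⟨w, hwW, rfl⟩ := Finset.mem_map.mp hw
    refine ⟨w, hwW, ?_⟩
    rcases h with ⟨i, hi⟩ | ⟨v, hv, hvd⟩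
    · have hwU : y w ∈ U := Set.mem_iUnion.mpr ⟨i, hi⟩
      exact (w.2 (Finset.mem_filter.mpr ⟨Finset.mem_univ _, hwU⟩)).elim
    · by_cases hvT : v ∈ Finset.univ.filter fun t => y t ∈ U
      · exact Or.inl ⟨⟨v, hvT⟩, hvd⟩
      · refine Or.inr ⟨⟨v, hvT⟩, fun hc => hv ?_, hvd⟩
        exact Finset.mem_map.mpr ⟨_, hc, rfl⟩
  calc _ ≤ ∑ T : Finset σ, volume ((MeasurableEquiv.piEquivPiSubtypeProd
        (fun _ : σ => EuclideanSpace ℝ (Fin d)) (fun x => x ∈ T)) ⁻¹' B T) := by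
        refine (measure_mono hcover).trans ((measure_iUnion_le _).trans ?_)
        rw [tsum_fintype]
    _ = ∑ T : Finset σ, volume (B T) := by
        refine Finset.sum_congr rfl fun T _ => ?_
        have := (volume_preserving_piEquivPiSubtypeProd
          (fun _ : σ => EuclideanSpace ℝ (Fin d)) (fun x => x ∈ T)).measure_preimage
            (hBm T).nullMeasurableSet
        convert this using 1
        congr!
    _ ≤ ∑ T : Finset σ,
        ((Fintype.card ρ ^ T.card * cc T.card (s - T.card) : ℕ) : ENNReal) * V ^ s :=
        Finset.sum_le_sum fun T _ => hB T
    _ = _ := by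
        rw [← Finset.sum_mul, ← Nat.cast_sum]
        congr 2
        rw [← Finset.powerset_univ, Finset.sum_powerset_apply_card
          (fun k => Fintype.card ρ ^ k * cc k (s - k)), Finset.card_univ, hs]
        obtain ⟨n, rfl⟩ : ∃ n, s = n + 1 := ⟨s - 1, by omega⟩
        have := cc_sum (Fintype.card ρ) n
        simp only [smul_eq_mul]
        rw [this]
        simp [cc]

end CayleyVol

/-- Cayley-type volume bound: the set of `(y₁, …, y_{m-1}) ∈ (ℝ^d)^{m-1}` for which the
geometric graph (threshold `2`) on the `m` points `0, y₁, …, y_{m-1}` is connected has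
Lebesgue measure at most `m^{m-2} · V_d^{m-1}`, where `V_d` is the volume of a ball of
radius `2` in `ℝ^d`. -/
theorem stmt_14 (d m : ℕ) (hd : 1 ≤ d) (hm : 2 ≤ m) :
    volume {y : Fin (m - 1) → EuclideanSpace ℝ (Fin d) |
      (SimpleGraph.fromRel (fun i j : Fin m =>
        ‖(if h : (i : ℕ) = 0 then 0 else y ⟨(i : ℕ) - 1, by omega⟩) -
          (if h : (j : ℕ) = 0 then 0 else y ⟨(j : ℕ) - 1, by omega⟩)‖ < 2)).Connected}
      ≤ (m : ENNReal) ^ (m - 2) *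
        (volume (Metric.ball (0 : EuclideanSpace ℝ (Fin d)) 2)) ^ (m - 1) := by
  have key := CayleyVol.main_bound d (m - 1) (Fin (m - 1)) Unit (fun _ => 0) (by simp)
  have hc : CayleyVol.cc (Fintype.card Unit) (m - 1) = m ^ (m - 2) := by
    have h1 : m - 1 ≠ 0 := by omega
    have h2 : 1 + (m - 1) = m := by omega
    have h3 : m - 1 - 1 = m - 2 := by omega
    simp [CayleyVol.cc, h1, h2, h3]
  rw [hc, Nat.cast_pow] at key
  refine (measure_mono ?_).trans key
  intro y hy W hW
  obtain ⟨w₀, hw₀⟩ := hW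
  let S : Set (Fin m) := {i | ∃ w ∈ W, (i : ℕ) = (w : ℕ) + 1}
  obtain ⟨q⟩ := hy.preconnected (⟨w₀ + 1, by omega⟩ : Fin m) ⟨0, by omega⟩
  obtain ⟨e, -, ⟨w, hw, hwe⟩, h2⟩ := q.exists_boundary_dart S ⟨w₀, hw₀, rfl⟩ (by
    rintro ⟨w, -, h⟩; simp at h)
  have hadj := e.adj
  rw [SimpleGraph.fromRel_adj] at hadj
  obtain ⟨-, hadj⟩ := hadj
  have hadj := hadj.elim id (fun h => by rwa [norm_sub_rev])
  have hfst : (e.fst : ℕ) ≠ 0 := by omega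
  have hyw : (⟨(e.fst : ℕ) - 1, by omega⟩ : Fin (m - 1)) = w := by ext; simp [hwe]
  rw [dif_neg hfst, hyw] at hadj
  refine ⟨w, hw, ?_⟩
  by_cases hs : (e.snd : ℕ) = 0
  · left
    refine ⟨(), ?_⟩
    rw [dif_pos hs] at hadj
    rwa [dist_eq_norm]
  · right
    rw [dif_neg hs] at hadj
    refine ⟨_, fun hW' => h2 ⟨_, hW', ?_⟩, by rw [dist_eq_norm]; exact hadj⟩
    simp only
    omega
end

section
/- Let p ≥ 1 be a fixed integer. Then lim_{n→∞} n^{−p} · Σ_{m=0}^∞ e^{−n} (n^m / m!) · |binom(m, p) − binom(n, p)| = 0, where n ranges over the positive integers and binom(·, p) denotes the binomial coefficient (equal to 0 when the top argument is less than p). -/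
open Filter Topology

lemma aux_hasSum (x : ℝ) (k : ℕ) :
    HasSum (fun m : ℕ => Real.exp (-x) * x ^ m / (m.factorial : ℝ) * (m.choose k : ℝ))
      (x ^ k / (k.factorial : ℝ)) := by
  have h0 : ∀ m ∈ Finset.range k,
      Real.exp (-x) * x ^ m / (m.factorial : ℝ) * (m.choose k : ℝ) = 0 := by
    intro m hm
    rw [Nat.choose_eq_zero_of_lt (Finset.mem_range.mp hm)]
    simp
  rw [← hasSum_nat_add_iff' k, Finset.sum_eq_zero h0, sub_zero]
  have h1 : HasSum (fun m : ℕ => x ^ m / (m.factorial : ℝ)) (Real.exp x) := by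
    rw [Real.exp_eq_exp_ℝ]
    exact NormedSpace.expSeries_div_hasSum_exp x
  have h2 := h1.mul_left (Real.exp (-x) * (x ^ k / (k.factorial : ℝ)))
  have h3 : Real.exp (-x) * (x ^ k / (k.factorial : ℝ)) * Real.exp x
      = x ^ k / (k.factorial : ℝ) := by
    rw [mul_right_comm, ← Real.exp_add]
    simp
  rw [h3] at h2
  refine h2.congr_fun ?_ 
  intro m
  have h4 : ((m + k).choose k : ℝ) * k.factorial * m.factorial = (m + k).factorial := by
    have := Nat.add_choose_mul_factorial_mul_factorial m k
    rw [← this]; push_cast; ring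
  have hk : (k.factorial : ℝ) ≠ 0 := by positivity
  have hm : (m.factorial : ℝ) ≠ 0 := by positivity
  have hmk : ((m + k).factorial : ℝ) ≠ 0 := by positivity
  field_simp
  rw [← h4]; ring

lemma aux_choose (n q : ℕ) (d m : ℕ) (h : m + d = n) :
    (n.choose (q + 1) : ℝ) - (m.choose (q + 1) : ℝ) ≤ d * (n : ℝ) ^ q := by
  induction d generalizing m with
  | zero => subst h; simp
  | succ d ih =>
    have h1 := ih (m + 1) (by omega)
    have h2 : ((m.choose q : ℕ) : ℝ) ≤ (n : ℝ) ^ q := by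
      have : m.choose q ≤ n ^ q :=
        (Nat.choose_le_pow m q).trans (Nat.pow_le_pow_left (by omega) q)
      exact_mod_cast this
    rw [Nat.choose_succ_succ] at h1
    push_cast at h1 ⊢
    linarith

lemma aux_point (n q m : ℕ) (hn : 0 < n) :
    |(m.choose (q + 1) : ℝ) - (n.choose (q + 1) : ℝ)| ≤
      (m.choose (q + 1) : ℝ) - (n.choose (q + 1) : ℝ) +
        (n : ℝ) ^ q * (√n + ((m : ℝ) - n) ^ 2 / √n) := by
  have hs : 0 < √(n : ℝ) := Real.sqrt_pos.mpr (by exact_mod_cast hn)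
  rcases le_total n m with h | h
  · have : (n.choose (q + 1) : ℝ) ≤ m.choose (q + 1) := by
      exact_mod_cast Nat.choose_le_choose (q + 1) h
    rw [abs_of_nonneg (by linarith)]
    have : 0 ≤ (n : ℝ) ^ q * (√n + ((m : ℝ) - n) ^ 2 / √n) := by positivity
    linarith
  · have h1 : (m.choose (q + 1) : ℝ) ≤ n.choose (q + 1) := by
      exact_mod_cast Nat.choose_le_choose (q + 1) h
    rw [abs_of_nonpos (by linarith)]
    have h2 := aux_choose n q (n - m) m (by omega)
    rw [Nat.cast_sub h] at h2
    have h3 : 2 * ((n : ℝ) - m) ≤ √n + ((m : ℝ) - n) ^ 2 / √n := by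
      have : √n + ((m : ℝ) - n) ^ 2 / √n - 2 * ((n : ℝ) - m) = (√n - (n - m)) ^ 2 / √n := by
        field_simp
        ring
      have h5 : 0 ≤ (√n - ((n : ℝ) - m)) ^ 2 / √n := by positivity
      linarith
    have h4 := mul_le_mul_of_nonneg_left h3 (by positivity : 0 ≤ (n : ℝ) ^ q)
    linarith

lemma aux_bound (n q : ℕ) (hn : 0 < n) :
    ∑' m : ℕ, Real.exp (-(n : ℝ)) * (n : ℝ) ^ m / (m.factorial : ℝ) *
        |((m.choose (q + 1) : ℝ)) - ((n.choose (q + 1) : ℝ))| ≤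
      (n : ℝ) ^ (q + 1) / ((q + 1).factorial : ℝ) - n.choose (q + 1) + 2 * (n : ℝ) ^ q * √n := by
  have hs : 0 < √(n : ℝ) := Real.sqrt_pos.mpr (by exact_mod_cast hn)
  have hs2 : √(n : ℝ) * √n = n := Real.mul_self_sqrt (by positivity)
  have H := aux_hasSum (n : ℝ)
  have key := ((H (q + 1)).add ((H 0).mul_left
    (-(n.choose (q + 1) : ℝ) + (n : ℝ) ^ q * √n + (n : ℝ) ^ q / √n * n ^ 2))).add
    (((H 2).mul_left ((n : ℝ) ^ q / √n * 2)).add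
      ((H 1).mul_left ((n : ℝ) ^ q / √n * (1 - 2 * n))))
  have hle : ∀ m : ℕ, Real.exp (-(n : ℝ)) * (n : ℝ) ^ m / (m.factorial : ℝ) *
        |((m.choose (q + 1) : ℝ)) - ((n.choose (q + 1) : ℝ))| ≤
      Real.exp (-(n : ℝ)) * (n : ℝ) ^ m / (m.factorial : ℝ) *
        ((m.choose (q + 1) : ℝ) - (n.choose (q + 1) : ℝ) +
        (n : ℝ) ^ q * (√n + ((m : ℝ) - n) ^ 2 / √n)) := fun m =>
    mul_le_mul_of_nonneg_left (aux_point n q m hn) (by positivity)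
  replace key := key.congr_fun (g := fun m : ℕ =>
      Real.exp (-(n : ℝ)) * (n : ℝ) ^ m / (m.factorial : ℝ) *
        ((m.choose (q + 1) : ℝ) - (n.choose (q + 1) : ℝ) +
        (n : ℝ) ^ q * (√n + ((m : ℝ) - n) ^ 2 / √n))) (by
    intro m
    have h2 : (m.choose 2 : ℝ) = m * (m - 1) / 2 := Nat.cast_choose_two ℝ m
    rw [h2, Nat.choose_zero_right, Nat.choose_one_right]
    push_cast
    ring)
  have hsum := Summable.of_nonneg_of_le (fun m => by positivity) hle key.summable
  refine (hsum.tsum_le_tsum hle key.summable).trans (le_of_eq ?_)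
  rw [key.tsum_eq]
  have : (n : ℝ) / √n = √n := by rw [div_eq_iff hs.ne', hs2]
  simp only [Nat.factorial, pow_zero, pow_one]
  push_cast
  linear_combination (n : ℝ) ^ q * this

lemma aux_lim (p : ℕ) :
    Tendsto (fun n : ℕ => ((n : ℝ) ^ p)⁻¹ * (n.choose p : ℝ)) atTop
      (𝓝 (1 / (p.factorial : ℝ))) := by
  have h := (Asymptotics.IsEquivalent.refl (u := fun n : ℕ => ((n : ℝ) ^ p)⁻¹)
    (l := atTop)).mul (isEquivalent_choose p)
  refine h.symm.tendsto_nhds (tendsto_const_nhds.congr' ?_)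
  filter_upwards [eventually_gt_atTop 0] with n hn
  have hn' : (0 : ℝ) < n := by exact_mod_cast hn
  simp only [Pi.mul_apply]
  field_simp

/-- De-Poissonization bound (e:binom.bound): if `N_n` is Poisson with mean `n`, then
`n^{-p} E|binom(N_n, p) - binom(n, p)| → 0`. -/
theorem stmt_17 (p : ℕ) (hp : 1 ≤ p) :
    Tendsto (fun n : ℕ => ((n : ℝ) ^ p)⁻¹ *
      ∑' m : ℕ, Real.exp (-(n : ℝ)) * (n : ℝ) ^ m / (m.factorial : ℝ) *
        |((m.choose p : ℝ)) - ((n.choose p : ℝ))|)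
      atTop (𝓝 0) := by
  obtain ⟨q, rfl⟩ : ∃ q, p = q + 1 := ⟨p - 1, by omega⟩
  have hsq : Tendsto (fun n : ℕ => 2 * (√(n : ℝ))⁻¹) atTop (𝓝 (2 * 0)) :=
    ((Real.tendsto_sqrt_atTop.comp tendsto_natCast_atTop_atTop).inv_tendsto_atTop).const_mul 2
  have hl := ((tendsto_const_nhds (x := 1 / ((q + 1).factorial : ℝ))).sub
    (aux_lim (q + 1))).add hsq
  rw [sub_self, mul_zero, add_zero] at hl
  refine squeeze_zero' (Eventually.of_forall fun n => ?_) ?_ hl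
  · exact mul_nonneg (by positivity) (tsum_nonneg fun m => by positivity)
  · filter_upwards [eventually_gt_atTop 0] with n hn
    have hn' : (0 : ℝ) < n := by exact_mod_cast hn
    have hs : 0 < √(n : ℝ) := Real.sqrt_pos.mpr hn'
    have hs2 : √(n : ℝ) ^ 2 = n := Real.sq_sqrt hn'.le
    refine (mul_le_mul_of_nonneg_left (aux_bound n q hn) (by positivity)).trans (le_of_eq ?_)
    have e : ((n : ℝ) ^ (q + 1))⁻¹ * (2 * (n : ℝ) ^ q * √n) = 2 * (√(n : ℝ))⁻¹ := by
      field_simp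
      rw [hs2, pow_succ]
    have e2 : ((n : ℝ) ^ (q + 1))⁻¹ * (n : ℝ) ^ (q + 1) = 1 :=
      inv_mul_cancel₀ (by positivity)
    linear_combination e + e2 / ((q + 1).factorial : ℝ)
end
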